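/- Let λ_1 ∈ ℝ, m, k ∈ ℕ, and let D ∈ ℂ^{(m+k)×(m+k)} be the block-diagonal Hermitian matrix with blocks D_1 = λ_1 I_m and a real diagonal matrix D_2 ∈ ℝ^{k×k}. Set gap = min_j |λ_1 − D_2(j,j)| and assume gap > 0. Let E_1 ∈ ℂ^{m×k}, define B_1 ∈ ℂ^{m×k} by B_1(p,j) = E_1(p,j)/(λ_1 − D_2(j,j)), and let E ∈ ℂ^{(m+k)×(m+k)} be the Hermitian matrix with zero diagonal blocks and off-diagonal blocks E_1 (upper right) and E_1ᴴ (lower left). Assume ‖E_1‖ < gap. Let t ∈ [0,1], let x ∈ ℂ^{m+k} with ‖x‖ = 1 and μ ∈ ℝ satisfy (D + tE)x = μx, and assume |μ − λ_1| ≤ (t/2)‖B_1 E_1ᴴ + E_1 B_1ᴴ‖ + (2/3) t² ‖E_1‖²‖B_1‖/(gap − ‖E_1‖) and |μ − λ_1| ≤ ‖E_1‖. Writing x = (x_top, x_bot) with x_top ∈ ℂ^m, x_bot ∈ ℂ^k, we have ‖x_bot − t B_1ᴴ x_top‖ ≤ (1/(gap − ‖E_1‖)) ( (t²/2)‖B_1‖‖B_1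 E_1ᴴ + E_1 B_1ᴴ‖ + (2/3) t³ ‖B_1‖²‖E_1‖²/(gap − ‖E_1‖) ). -/

import Mathlib

open Matrix

/-- The spectral norm (operator norm induced by the Euclidean norm) of a complex matrix. -/
noncomputable def specNorm {m n : Type*} [Fintype m] [Fintype n] [DecidableEq n]
    (M : Matrix m n ℂ) : ℝ :=
  ‖LinearMap.toContinuousLinearMap (Matrix.toEuclideanLin M)‖

/-- The Euclidean norm of a complex vector. -/
noncomputable def evnorm {n : Type*} [Fintype n] (v : n → ℂ) : ℝ :=
  ‖(WithLp.equiv 2 (n → ℂ)).symm v‖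

open scoped Matrix.Norms.L2Operator in
theorem specNorm_conjTranspose {m n : Type*} [Fintype m] [Fintype n] [DecidableEq m]
    [DecidableEq n] (M : Matrix m n ℂ) : specNorm Mᴴ = specNorm M :=
  Matrix.l2_opNorm_conjTranspose M

theorem specNorm_nonneg {m n : Type*} [Fintype m] [Fintype n] [DecidableEq n]
    (M : Matrix m n ℂ) : 0 ≤ specNorm M :=
  norm_nonneg _

theorem evnorm_mulVec_le {m n : Type*} [Fintype m] [Fintype n] [DecidableEq n]
    (M : Matrix m n ℂ) (v : n → ℂ) : evnorm (M *ᵥ v) ≤ specNorm M * evnorm v :=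
  (LinearMap.toContinuousLinearMap (Matrix.toEuclideanLin M)).le_opNorm (WithLp.toLp 2 v)

theorem evnorm_eq_sqrt {n : Type*} [Fintype n] (v : n → ℂ) :
    evnorm v = √(∑ i, ‖v i‖ ^ 2) :=
  EuclideanSpace.norm_eq (WithLp.toLp 2 v)

theorem evnorm_inl_le {m n : Type*} [Fintype m] [Fintype n] (x : m ⊕ n → ℂ) :
    evnorm (fun a => x (Sum.inl a)) ≤ evnorm x := by
  rw [evnorm_eq_sqrt, evnorm_eq_sqrt, Fintype.sum_sum_type]
  exact Real.sqrt_le_sqrt (le_add_of_nonneg_right (by positivity))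

theorem mul_evnorm_le_mul_evnorm {n : Type*} [Fintype n] {g c : ℝ} (hg : 0 ≤ g) (hc : 0 ≤ c)
    {v w : n → ℂ} (h : ∀ i, g * ‖v i‖ ≤ c * ‖w i‖) : g * evnorm v ≤ c * evnorm w := by
  rw [evnorm_eq_sqrt, evnorm_eq_sqrt]
  conv_lhs => rw [← Real.sqrt_sq hg]
  conv_rhs => rw [← Real.sqrt_sq hc]
  rw [← Real.sqrt_mul (sq_nonneg g), ← Real.sqrt_mul (sq_nonneg c), Finset.mul_sum,
    Finset.mul_sum]
  refine Real.sqrt_le_sqrt (Finset.sum_le_sum fun i _ => ?_)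
  rw [← mul_pow, ← mul_pow]
  exact pow_le_pow_left₀ (by positivity) (h i) 2

/-- refined eigenvector bound in the `2×2` block-diagonal Hermitian case
with `D₁ = λ₁ I`. -/
theorem stmt_12 {m k : ℕ} (lam1 : ℝ) (d : Fin k → ℝ)
    (gap : ℝ) (hgap : gap = ⨅ j : Fin k, |lam1 - d j|) (hgap0 : 0 < gap)
    (E₁ B₁ : Matrix (Fin m) (Fin k) ℂ)
    (hB₁ : ∀ p j, B₁ p j = E₁ p j / ((lam1 : ℂ) - (d j : ℂ)))
    (D E : Matrix (Fin m ⊕ Fin k) (Fin m ⊕ Fin k) ℂ)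
    (hD : D = Matrix.fromBlocks ((lam1 : ℂ) • 1) 0 0 (Matrix.diagonal fun j => (d j : ℂ)))
    (hEdef : E = Matrix.fromBlocks 0 E₁ E₁ᴴ 0)
    (hE1small : specNorm E₁ < gap)
    (t : ℝ) (ht : t ∈ Set.Icc (0:ℝ) 1)
    (x : Fin m ⊕ Fin k → ℂ) (hx1 : evnorm x = 1)
    (μ : ℝ) (heig : (D + (t : ℂ) • E) *ᵥ x = (μ : ℂ) • x)
    (hμ1 : |μ - lam1| ≤ t/2 * specNorm (B₁ * E₁ᴴ + E₁ * B₁ᴴ) +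
      2/3 * t^2 * specNorm E₁ ^ 2 * specNorm B₁ / (gap - specNorm E₁))
    (hμ2 : |μ - lam1| ≤ specNorm E₁) :
    evnorm ((fun b => x (Sum.inr b)) - (t : ℂ) • (B₁ᴴ *ᵥ fun a => x (Sum.inl a))) ≤
      (1 / (gap - specNorm E₁)) *
        (t^2/2 * specNorm B₁ * specNorm (B₁ * E₁ᴴ + E₁ * B₁ᴴ) +
          2/3 * t^3 * specNorm B₁ ^ 2 * specNorm E₁ ^ 2 / (gap - specNorm E₁)) := by
  have hgE : 0 < gap - specNorm E₁ := sub_pos.mpr hE1small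
  have ht0 : 0 ≤ t := ht.1
  have hgap_le (j : Fin k) : gap ≤ |lam1 - d j| :=
    hgap ▸ ciInf_le (Set.finite_range _).bddBelow j
  set z : Fin k → ℂ := B₁ᴴ *ᵥ fun a => x (Sum.inl a) with hz
  have hE₁z (j : Fin k) :
      (E₁ᴴ *ᵥ fun a => x (Sum.inl a)) j = ((lam1 : ℂ) - d j) * z j := by
    have hne : (lam1 : ℂ) - d j ≠ 0 := by
      have h : lam1 - d j ≠ 0 := abs_pos.mp (hgap0.trans_le (hgap_le j))
      exact_mod_cast h
    simp only [hz, Matrix.mulVec, dotProduct, Finset.mul_sum, Matrix.conjTranspose_apply, hB₁]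
    refine Finset.sum_congr rfl fun a _ => ?_
    simp only [star_div₀, star_sub, Complex.star_def, Complex.conj_ofReal]
    field_simp
  have hrow (j : Fin k) :
      (d j : ℂ) * x (Sum.inr j) + t * (((lam1 : ℂ) - d j) * z j) = μ * x (Sum.inr j) := by
    have h := congrFun heig (Sum.inr j)
    rw [← hE₁z j]
    subst hD hEdef
    simpa [Matrix.add_mulVec, Matrix.smul_mulVec, Matrix.fromBlocks_mulVec,
      Matrix.mulVec_diagonal, Function.comp_def] using h
  have hentry (j : Fin k) :
      (gap - specNorm E₁) * ‖((fun b => x (Sum.inr b)) - (t : ℂ) • z) j‖ ≤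
        (t * |μ - lam1|) * ‖z j‖ := by
    have hEq : ((μ : ℂ) - d j) * ((fun b => x (Sum.inr b)) - (t : ℂ) • z) j =
        -(t * ((μ : ℂ) - lam1) * z j) := by
      simp only [Pi.sub_apply, Pi.smul_apply, smul_eq_mul]
      linear_combination -hrow j
    have hnorm := congrArg norm hEq
    rw [norm_neg, norm_mul, norm_mul, norm_mul, ← Complex.ofReal_sub, ← Complex.ofReal_sub,
      Complex.norm_real, Complex.norm_real, Complex.norm_real, Real.norm_eq_abs,
      Real.norm_eq_abs, Real.norm_eq_abs, abs_of_nonneg ht0] at hnorm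
    rw [← hnorm]
    gcongr
    have h := abs_sub_le lam1 μ (d j)
    rw [abs_sub_comm lam1 μ] at h
    linarith [hgap_le j]
  have hz_le : evnorm z ≤ specNorm B₁ := by
    calc evnorm z ≤ specNorm B₁ᴴ * evnorm (fun a => x (Sum.inl a)) := evnorm_mulVec_le _ _
      _ ≤ specNorm B₁ * 1 := by
        rw [specNorm_conjTranspose]
        exact mul_le_mul_of_nonneg_left (hx1 ▸ evnorm_inl_le x) (specNorm_nonneg _)
      _ = specNorm B₁ := mul_one _
  rw [one_div_mul_eq_div, le_div_iff₀' hgE]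
  calc _ ≤ (t * |μ - lam1|) * evnorm z :=
        mul_evnorm_le_mul_evnorm hgE.le (by positivity) hentry
    _ ≤ (t * (t/2 * specNorm (B₁ * E₁ᴴ + E₁ * B₁ᴴ) +
          2/3 * t^2 * specNorm E₁ ^ 2 * specNorm B₁ / (gap - specNorm E₁))) * specNorm B₁ := by
        have := (abs_nonneg _).trans hμ1
        have := norm_nonneg (WithLp.toLp 2 z)
        gcongr
    _ = _ := by ring
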